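/- arXiv:1401.4927 — 2 statements merged into one kernel-verified Lean document; each statement's English description precedes it below -/
import Mathlib

section
/- For a matrix game u : Fin m → Fin n → ℝ with entries in {0,1}: 𝒱(u) = 1 if and only if some row i satisfies u i j = 1 for all j (Eloise has a winning pure strategy), and 𝒱(u) = 0 if and only if some column j satisfies u i j = 0 for all i (Abelard has a winning pure strategy). -/
open Finset

/-- A mixed strategy over a finite index type: nonnegative weights summing to 1. -/
def IsMixed {α : Type*} [Fintype α] (μ : α → ℝ) : Prop :=
  (∀ i, 0 ≤ μ i) ∧ ∑ i, μ i = 1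

/-- Expected utility for Eloise when she plays mixed strategy `μ` (rows)
and Abelard plays mixed strategy `ν` (columns) in the matrix game `u`. -/
noncomputable def EU {α β : Type*} [Fintype α] [Fintype β]
    (u : α → β → ℝ) (μ : α → ℝ) (ν : β → ℝ) : ℝ :=
  ∑ i, ∑ j, μ i * ν j * u i j

/-- The value of the matrix game `u`:
sup over Eloise's mixed strategies of the inf over Abelard's mixed strategies
of the expected utility. -/
noncomputable def gameValue {α β : Type*} [Fintype α] [Fintype β]
    (u : α → β → ℝ) : ℝ :=
  ⨆ μ : {μ : α → ℝ // IsMixed μ}, ⨅ ν : {ν : β → ℝ // IsMixed ν}, EU u μ.1 ν.1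

section MatrixGame

variable {α β : Type*} [Fintype α] [Fintype β]

lemma isMixed_single [DecidableEq α] (a : α) : IsMixed (Pi.single a 1 : α → ℝ) :=
  ⟨fun i => by by_cases h : i = a <;> simp [h], by simp⟩

lemma isMixed_uniform [Nonempty α] :
    IsMixed (fun _ : α => (Fintype.card α : ℝ)⁻¹) :=
  ⟨fun _ => by positivity, by simp⟩

lemma IsMixed.sum_mul_le {μ f : α → ℝ} {c : ℝ} (hμ : IsMixed μ) (hf : ∀ i, f i ≤ c) :
    ∑ i, μ i * f i ≤ c :=
  calc ∑ i, μ i * f i ≤ ∑ i, μ i * c :=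
        sum_le_sum fun i _ => mul_le_mul_of_nonneg_left (hf i) (hμ.1 i)
    _ = c := by rw [← sum_mul, hμ.2, one_mul]

lemma IsMixed.le_sum_mul {μ f : α → ℝ} {c : ℝ} (hμ : IsMixed μ) (hf : ∀ i, c ≤ f i) :
    c ≤ ∑ i, μ i * f i :=
  calc c = ∑ i, μ i * c := by rw [← sum_mul, hμ.2, one_mul]
    _ ≤ ∑ i, μ i * f i :=
        sum_le_sum fun i _ => mul_le_mul_of_nonneg_left (hf i) (hμ.1 i)

lemma EU_eq_sum_rows (u : α → β → ℝ) (μ : α → ℝ) (ν : β → ℝ) :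
    EU u μ ν = ∑ i, μ i * ∑ j, ν j * u i j := by
  simp only [EU, mul_sum, mul_assoc]

lemma EU_eq_sum_columns (u : α → β → ℝ) (μ : α → ℝ) (ν : β → ℝ) :
    EU u μ ν = ∑ j, ν j * ∑ i, μ i * u i j := by
  rw [EU, sum_comm]
  simp only [mul_sum, mul_assoc, mul_left_comm]

lemma bddBelow_range_EU {u : α → β → ℝ} (hu : ∀ i j, 0 ≤ u i j) {μ : α → ℝ} (hμ : IsMixed μ) :
    BddBelow (Set.range fun ν : {ν : β → ℝ // IsMixed ν} => EU u μ ν.1) := by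
  refine ⟨0, ?_⟩
  rintro _ ⟨ν, rfl⟩
  dsimp only
  rw [EU_eq_sum_rows]
  exact hμ.le_sum_mul fun i => ν.2.le_sum_mul (hu i)

/-- A mixed strategy of Abelard bounds from above what any mixed strategy of Eloise guarantees. -/
lemma iInf_EU_le {u : α → β → ℝ} (hu : ∀ i j, 0 ≤ u i j) {μ : α → ℝ} (hμ : IsMixed μ)
    {ν : β → ℝ} (hν : IsMixed ν) {c : ℝ} (hc : ∀ i, ∑ j, ν j * u i j ≤ c) :
    ⨅ ν : {ν : β → ℝ // IsMixed ν}, EU u μ ν.1 ≤ c := by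
  refine (ciInf_le (bddBelow_range_EU hu hμ) ⟨ν, hν⟩).trans ?_
  dsimp only
  rw [EU_eq_sum_rows]
  exact hμ.sum_mul_le hc

lemma gameValue_le [Nonempty α] {u : α → β → ℝ} (hu : ∀ i j, 0 ≤ u i j)
    {ν : β → ℝ} (hν : IsMixed ν) {c : ℝ} (hc : ∀ i, ∑ j, ν j * u i j ≤ c) :
    gameValue u ≤ c := by
  have : Nonempty {μ : α → ℝ // IsMixed μ} := ⟨⟨_, isMixed_uniform⟩⟩
  exact ciSup_le fun μ => iInf_EU_le hu μ.2 hν hc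

lemma le_gameValue [Nonempty β] {u : α → β → ℝ} (hu : ∀ i j, 0 ≤ u i j)
    (hu' : ∀ i j, u i j ≤ 1) {μ : α → ℝ} (hμ : IsMixed μ) {c : ℝ}
    (hc : ∀ j, c ≤ ∑ i, μ i * u i j) : c ≤ gameValue u := by
  have : Nonempty {ν : β → ℝ // IsMixed ν} := ⟨⟨_, isMixed_uniform⟩⟩
  have hbdd : BddAbove (Set.range fun μ : {μ : α → ℝ // IsMixed μ} =>
      ⨅ ν : {ν : β → ℝ // IsMixed ν}, EU u μ.1 ν.1) := by
    refine ⟨1, ?_⟩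
    rintro _ ⟨μ, rfl⟩
    exact iInf_EU_le hu μ.2 isMixed_uniform fun i => isMixed_uniform.sum_mul_le (hu' i)
  refine le_ciSup_of_le hbdd ⟨μ, hμ⟩ (le_ciInf fun ν => ?_)
  rw [EU_eq_sum_columns]
  exact ν.2.le_sum_mul hc

end MatrixGame

/-- `𝒱(u) = 1` iff Eloise has a winning pure strategy (a row of all ones), and
`𝒱(u) = 0` iff Abelard has a winning pure strategy (a column of all zeros). -/
theorem value_extreme_iff_winning_strategy (m n : ℕ) (hm : 1 ≤ m) (hn : 1 ≤ n)
    (u : Fin m → Fin n → ℝ) (hu : ∀ i j, u i j = 0 ∨ u i j = 1) :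
    (gameValue u = 1 ↔ ∃ i : Fin m, ∀ j : Fin n, u i j = 1)
    ∧ (gameValue u = 0 ↔ ∃ j : Fin n, ∀ i : Fin m, u i j = 0) := by
  have : NeZero m := ⟨by omega⟩
  have : NeZero n := ⟨by omega⟩
  have hu0 : ∀ i j, 0 ≤ u i j := fun i j => by rcases hu i j with h | h <;> simp [h]
  have hu1 : ∀ i j, u i j ≤ 1 := fun i j => by rcases hu i j with h | h <;> simp [h]
  have hm0 : (0 : ℝ) < (m : ℝ)⁻¹ := by positivity
  have hn0 : (0 : ℝ) < (n : ℝ)⁻¹ := by positivity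
  refine ⟨⟨fun hv => ?_, ?_⟩, ⟨fun hv => ?_, ?_⟩⟩
  · by_contra! h
    have hle : gameValue u ≤ 1 - (n : ℝ)⁻¹ := by
      refine gameValue_le hu0 isMixed_uniform fun i => ?_
      obtain ⟨j, hj⟩ := h i
      have hsum : ∑ j, (n : ℝ)⁻¹ * (1 - u i j) = 1 - ∑ j, (n : ℝ)⁻¹ * u i j := by
        simp [mul_sub, sum_sub_distrib]
      have hterm := single_le_sum (f := fun j => (n : ℝ)⁻¹ * (1 - u i j))
        (fun k _ => mul_nonneg hn0.le (sub_nonneg.2 (hu1 i k))) (mem_univ j)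
      simp only [(hu i j).resolve_right hj, hsum] at hterm
      rw [Fintype.card_fin]
      linarith
    linarith
  · rintro ⟨i, hi⟩
    refine le_antisymm (gameValue_le hu0 isMixed_uniform fun i =>
      isMixed_uniform.sum_mul_le (hu1 i)) (le_gameValue hu0 hu1 (isMixed_single i) fun j => ?_)
    simp [Pi.single_apply, hi]
  · by_contra! h
    have hle : (m : ℝ)⁻¹ ≤ gameValue u := by
      refine le_gameValue hu0 hu1 isMixed_uniform fun j => ?_
      obtain ⟨i, hi⟩ := h j
      have hterm := single_le_sum (f := fun i => (m : ℝ)⁻¹ * u i j)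
        (fun k _ => mul_nonneg hm0.le (hu0 k j)) (mem_univ i)
      simpa [(hu i j).resolve_left hi] using hterm
    linarith
  · rintro ⟨j, hj⟩
    refine le_antisymm (gameValue_le hu0 (isMixed_single j) fun i => ?_)
      (le_gameValue hu0 hu1 isMixed_uniform fun j => isMixed_uniform.le_sum_mul (hu0 · j))
    simp [Pi.single_apply, hj]
end

section
/- (Value of the birthday game.) Let 1 ≤ m ≤ n and define the matrix game u whose rows and columns are both indexed by tuples in Fin m → ZMod n, with u b a = 1 if there exist indices i < j in Fin m with a i + b i = a j + b j, and u b a = 0 otherwise (Eloise plays the row tuple b, Abelard the column tuple a). Then u is balanced and 𝒱(u) = 1 − n!/(n^m · (n−m)!), the probability that a random sample of m elements from an n-element set (drawn with replacement) contains at least one pair of duplicates. -/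
open Finset

open scoped Classical

theorem IsMixed.uniform (α : Type*) [Fintype α] [Nonempty α] :
    IsMixed fun _ : α => (Fintype.card α : ℝ)⁻¹ :=
  ⟨fun _ => by positivity, by simp⟩

theorem EU_nonneg {α β : Type*} [Fintype α] [Fintype β] {u : α → β → ℝ}
    (hu : ∀ i j, 0 ≤ u i j) {μ : α → ℝ} {ν : β → ℝ} (hμ : IsMixed μ) (hν : IsMixed ν) :
    0 ≤ EU u μ ν :=
  sum_nonneg fun i _ => sum_nonneg fun j _ => mul_nonneg (mul_nonneg (hμ.1 i) (hν.1 j)) (hu i j)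

theorem EU_uniform_right {α β : Type*} [Fintype α] [Fintype β] {u : α → β → ℝ} {r : ℝ}
    (hr : ∀ i, ∑ j, u i j = r) {μ : α → ℝ} (hμ : IsMixed μ) :
    EU u μ (fun _ => (Fintype.card β : ℝ)⁻¹) = r / Fintype.card β := by
  simp only [EU, ← mul_sum, hr, ← sum_mul, hμ.2]
  ring

theorem EU_uniform_left {α β : Type*} [Fintype α] [Fintype β] {u : α → β → ℝ} {c : ℝ}
    (hc : ∀ j, ∑ i, u i j = c) {ν : β → ℝ} (hν : IsMixed ν) :
    EU u (fun _ => (Fintype.card α : ℝ)⁻¹) ν = c / Fintype.card α := by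
  rw [EU, sum_comm]
  simp only [← mul_sum, hc, ← sum_mul, hν.2]
  ring

/-- The value of a balanced nonnegative game is the density of any of its rows. -/
theorem gameValue_of_balanced {α β : Type*} [Fintype α] [Fintype β] [Nonempty α] [Nonempty β]
    {u : α → β → ℝ} {r c : ℝ} (hu : ∀ i j, 0 ≤ u i j)
    (hr : ∀ i, ∑ j, u i j = r) (hc : ∀ j, ∑ i, u i j = c) :
    gameValue u = r / Fintype.card β := by
  have hrc : c / Fintype.card α = r / Fintype.card β := by
    rw [← EU_uniform_right hr (IsMixed.uniform α), EU_uniform_left hc (IsMixed.uniform β)]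
  have : Nonempty {μ : α → ℝ // IsMixed μ} := ⟨⟨_, IsMixed.uniform α⟩⟩
  have : Nonempty {ν : β → ℝ // IsMixed ν} := ⟨⟨_, IsMixed.uniform β⟩⟩
  have hle (μ : {μ : α → ℝ // IsMixed μ}) :
      ⨅ ν : {ν : β → ℝ // IsMixed ν}, EU u μ.1 ν.1 ≤ r / Fintype.card β := by
    rw [← EU_uniform_right hr μ.2]
    exact ciInf_le (f := fun ν : {ν : β → ℝ // IsMixed ν} => EU u μ.1 ν.1)
      ⟨0, Set.forall_mem_range.2 fun ν => EU_nonneg hu μ.2 ν.2⟩ ⟨_, IsMixed.uniform β⟩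
  refine le_antisymm (ciSup_le hle) ?_
  refine le_ciSup_of_le ⟨_, Set.forall_mem_range.2 hle⟩ ⟨_, IsMixed.uniform α⟩ ?_
  exact le_ciInf fun ν => (hrc.symm.trans (EU_uniform_left hc ν.2).symm).le

theorem exists_lt_map_eq_iff_not_injective {ι κ : Type*} [LinearOrder ι] (f : ι → κ) :
    (∃ i j, i < j ∧ f i = f j) ↔ ¬ Function.Injective f := by
  rw [Function.not_injective_iff]
  refine ⟨fun ⟨i, j, hij, h⟩ => ⟨i, j, h, hij.ne⟩, fun ⟨i, j, h, hij⟩ => ?_⟩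
  rcases hij.lt_or_gt with hij | hij
  exacts [⟨i, j, hij, h⟩, ⟨j, i, hij, h.symm⟩]

theorem card_filter_injective (ι κ : Type*) [Fintype ι] [Fintype κ] :
    #{f : ι → κ | Function.Injective f} = (Fintype.card κ).descFactorial (Fintype.card ι) := by
  rw [← Fintype.card_embedding_eq, ← Fintype.card_subtype]
  exact Fintype.card_congr (Equiv.subtypeInjectiveEquivEmbedding ι κ)

theorem sum_ite_exists_lt_map_eq (ι κ : Type*) [Fintype ι] [LinearOrder ι] [Fintype κ]
    [∀ f : ι → κ, Decidable (∃ i j, i < j ∧ f i = f j)] :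
    ∑ f : ι → κ, (if ∃ i j, i < j ∧ f i = f j then (1 : ℝ) else 0) =
      (Fintype.card κ : ℝ) ^ Fintype.card ι -
        ((Fintype.card κ).descFactorial (Fintype.card ι) : ℝ) := by
  simp only [exists_lt_map_eq_iff_not_injective]
  rw [sum_boole, ← card_filter_injective, eq_sub_iff_add_eq', ← Nat.cast_add, ← Nat.cast_pow,
    ← Fintype.card_fun, ← card_univ]
  congr 1
  convert card_filter_add_card_filter_not (s := (univ : Finset (ι → κ))) Function.Injective

/-- Value of the birthday game: Eloise plays a tuple `b`, Abelard a tuple `a`,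
and Eloise wins iff some pair `i < j` collides, i.e. `a i + b i = a j + b j`.
The game is balanced and its value is `1 − n!/(n^m·(n−m)!)`, the probability
that a random sample of `m` elements from an `n`-element set (with
replacement) contains a duplicate. -/
theorem birthday_game_value (m n : ℕ) (hm : 1 ≤ m) (hmn : m ≤ n) [NeZero n] :
    let u : (Fin m → ZMod n) → (Fin m → ZMod n) → ℝ := fun b a =>
      if ∃ i j : Fin m, i < j ∧ a i + b i = a j + b j then 1 else 0
    (∀ b b' : Fin m → ZMod n, ∑ a, u b a = ∑ a, u b' a)
    ∧ (∀ a a' : Fin m → ZMod n, ∑ b, u b a = ∑ b, u b a')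
    ∧ gameValue u
        = 1 - (n.factorial : ℝ) / ((n : ℝ) ^ m * ((n - m).factorial : ℝ)) := by
  intro u
  have hrow (b : Fin m → ZMod n) : ∑ a, u b a = (n : ℝ) ^ m - (n.descFactorial m : ℝ) := by
    have h := sum_ite_exists_lt_map_eq (Fin m) (ZMod n)
    rw [← Equiv.sum_comp (Equiv.addRight b), ZMod.card, Fintype.card_fin] at h
    rw [← h]
    exact sum_congr rfl fun a _ => ite_congr rfl (fun _ => rfl) fun _ => rfl
  have hcol (a : Fin m → ZMod n) : ∑ b, u b a = (n : ℝ) ^ m - (n.descFactorial m : ℝ) := by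
    rw [← hrow a]
    simp only [u, add_comm]
  refine ⟨fun b b' => by rw [hrow, hrow], fun a a' => by rw [hcol, hcol], ?_⟩
  have hu (b a : Fin m → ZMod n) : 0 ≤ u b a := by
    simp only [u]
    split_ifs <;> norm_num
  have hn : (n : ℝ) ≠ 0 := Nat.cast_ne_zero.2 (NeZero.ne n)
  have hfac : ((n - m).factorial : ℝ) ≠ 0 := Nat.cast_ne_zero.2 (Nat.factorial_ne_zero _)
  rw [gameValue_of_balanced hu hrow hcol, ← Nat.factorial_mul_descFactorial hmn]
  simp only [Fintype.card_fun, ZMod.card, Fintype.card_fin]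
  push_cast
  field_simp
end
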